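/- Let a, b be units of S, let τ ∈ Aut(S) commute with σ, and let G : S[t;σ]/S[t;σ](t^m−a) → S[t;σ]/S[t;σ](t^m−b) be an isomorphism such that G restricted to S equals τ and G(t) = α t^k for some k > 1 and some unit α of S. Then N_m^{σ^k}(α)·b^k = τ(a). -/

import Mathlib

/-- `Nsig σ i β = ∏_{j=0}^{i-1} σ^j(β)`. -/
def Nsig {S : Type*} [CommRing S] (σ : S ≃+* S) (i : ℕ) (β : S) : S :=
  ∏ j ∈ Finset.range i, (σ ^ j) β

/-- The coefficient vector of the monomial `c·t^k` in `S^m`. -/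
def stdVec {S : Type*} [Ring S] (m k : ℕ) (c : S) : Fin m → S :=
  fun j => if (j : ℕ) = k then c else 0

/-- Left multiplication by `t`, followed by reduction modulo `f = t^m − ∑ a_i t^i`,
on coefficient vectors representing elements of the Petit algebra `S[t;σ]/S[t;σ]f`. -/
def tmul {S : Type*} [Ring S] (σ : S ≃+* S) {m : ℕ} (a : Fin m → S)
    (c : Fin m → S) : Fin m → S :=
  fun j =>
    (if _ : (j : ℕ) = 0 then 0 else σ (c ⟨(j : ℕ) - 1, by have := j.isLt; omega⟩)) +
      σ (c ⟨m - 1, by have := j.isLt; omega⟩) * a j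

/-- The multiplication of the Petit algebra `S[t;σ]/S[t;σ]f`, `f = t^m − ∑ a_i t^i`:
`g ∘ h` is the remainder of the skew-polynomial product `g·h` under right division by `f`. -/
def petitMul {S : Type*} [Ring S] (σ : S ≃+* S) {m : ℕ} (a : Fin m → S)
    (g h : Fin m → S) : Fin m → S :=
  fun j => ∑ i : Fin m, g i * (tmul σ a)^[(i : ℕ)] h j

/-- The map `G_{τ,α} : ∑ d_i t^i ↦ ∑ τ(d_i) N_i^σ(α) t^i` on coefficient vectors. -/
def Gmap {S : Type*} [CommRing S] (σ τ : S ≃+* S) (α : S) {m : ℕ}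
    (d : Fin m → S) : Fin m → S :=
  fun i => τ (d i) * Nsig σ (i : ℕ) α

/-- `G` is an isomorphism from the Petit algebra `S[t;σ]/S[t;σ](t^m − ∑ a_i t^i)` to the
Petit algebra `S[t;σ]/S[t;σ](t^m − ∑ b_i t^i)`: a bijective, additive, unital and
multiplicative map on coefficient vectors. -/
def IsPetitIso {S : Type*} [Ring S] (σ : S ≃+* S) {m : ℕ} (a b : Fin m → S)
    (G : (Fin m → S) → (Fin m → S)) : Prop :=
  Function.Bijective G ∧ (∀ x y, G (x + y) = G x + G y) ∧
    G (stdVec m 0 1) = stdVec m 0 1 ∧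
    (∀ x y, G (petitMul σ a x y) = petitMul σ b (G x) (G y))

section PetitAlgebra

variable {S : Type*} [CommRing S]

lemma smul_stdVec (m k : ℕ) (c d : S) : c • stdVec m k d = stdVec m k (c * d) := by
  ext j
  simp [stdVec]

lemma stdVec_right_injective {m k : ℕ} (hk : k < m) :
    Function.Injective (stdVec m k : S → Fin m → S) := by
  intro c d h
  simpa [stdVec] using congrFun h ⟨k, hk⟩

lemma tmul_smul (σ : S ≃+* S) {m : ℕ} (a : Fin m → S) (c : S) (x : Fin m → S) :
    tmul σ a (c • x) = σ c • tmul σ a x := by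
  ext j
  by_cases hj : (j : ℕ) = 0 <;> simp [tmul, hj] <;> ring

lemma tmul_iterate_smul (σ : S ≃+* S) {m : ℕ} (a : Fin m → S) (n : ℕ) (c : S)
    (x : Fin m → S) :
    (tmul σ a)^[n] (c • x) = (σ ^ n) c • (tmul σ a)^[n] x := by
  induction n with
  | zero => simp
  | succ n ih =>
    rw [Function.iterate_succ_apply', Function.iterate_succ_apply', ih, tmul_smul, pow_succ',
      RingAut.mul_apply]

lemma tmul_stdVec_of_lt (σ : S ≃+* S) {m j : ℕ} (hj : j + 1 < m) (b c : S) :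
    tmul σ (stdVec m 0 b) (stdVec m j c) = stdVec m (j + 1) (σ c) := by
  ext i
  have h1 : ¬ m - 1 = j := by omega
  by_cases hi : (i : ℕ) = 0
  · simp [tmul, stdVec, hi, h1]
  · by_cases h2 : (i : ℕ) = j + 1
    · simp [tmul, stdVec, h2]
    · have h3 : ¬ (i : ℕ) - 1 = j := by omega
      simp [tmul, stdVec, hi, h2, h3]

lemma tmul_stdVec_last (σ : S ≃+* S) {m j : ℕ} (hm : 1 < m) (hj : j + 1 = m) (b c : S) :
    tmul σ (stdVec m 0 b) (stdVec m j c) = stdVec m 0 (σ c * b) := by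
  ext i
  have h1 : m - 1 = j := by omega
  by_cases hi : (i : ℕ) = 0
  · simp [tmul, stdVec, hi, h1]
  · have h3 : ¬ (i : ℕ) - 1 = j := by have := i.isLt; omega
    simp [tmul, stdVec, hi, h3]

lemma tmul_iterate_stdVec_zero (σ : S ≃+* S) {m j : ℕ} (hj : j < m) (b c : S) :
    (tmul σ (stdVec m 0 b))^[j] (stdVec m 0 c) = stdVec m j ((σ ^ j) c) := by
  induction j with
  | zero => simp
  | succ j ih =>
    rw [Function.iterate_succ_apply', ih (by omega), tmul_stdVec_of_lt σ hj, pow_succ',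
      RingAut.mul_apply]

lemma tmul_iterate_degree (σ : S ≃+* S) {m : ℕ} (hm : 1 < m) (b c : S) :
    (tmul σ (stdVec m 0 b))^[m] (stdVec m 0 c) = stdVec m 0 ((σ ^ m) c * b) := by
  obtain ⟨j, rfl⟩ : ∃ j, m = j + 1 := ⟨m - 1, by omega⟩
  rw [Function.iterate_succ_apply', tmul_iterate_stdVec_zero σ (by omega),
    tmul_stdVec_last σ hm rfl, pow_succ', RingAut.mul_apply]

lemma tmul_iterate_degree_mul (σ : S ≃+* S) {m : ℕ} (hm : 1 < m) (hσ : σ ^ m = 1) (b : S)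
    (q : ℕ) (c : S) :
    (tmul σ (stdVec m 0 b))^[m * q] (stdVec m 0 c) = stdVec m 0 (c * b ^ q) := by
  induction q with
  | zero => simp
  | succ q ih =>
    rw [mul_add_one, add_comm, Function.iterate_add_apply, ih, tmul_iterate_degree σ hm, hσ,
      RingAut.one_apply, pow_succ, mul_assoc]

lemma petitMul_stdVec_left (σ : S ≃+* S) {m r : ℕ} (hr : r < m) (a : Fin m → S) (u : S)
    (h : Fin m → S) :
    petitMul σ a (stdVec m r u) h = u • (tmul σ a)^[r] h := by
  ext j
  rw [petitMul, Finset.sum_eq_single ⟨r, hr⟩]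
  · simp [stdVec]
  · intro i _ hi
    have : ¬ (i : ℕ) = r := fun h => hi (Fin.ext h)
    simp [stdVec, this]
  · simp

lemma Nsig_succ (σ : S ≃+* S) (i : ℕ) (β : S) : Nsig σ (i + 1) β = β * σ (Nsig σ i β) := by
  simp only [Nsig, Finset.prod_range_succ', map_prod, pow_succ', RingAut.mul_apply, pow_zero,
    RingAut.one_apply, mul_comm]

lemma isUnit_Nsig (σ : S ≃+* S) (i : ℕ) {β : S} (hβ : IsUnit β) : IsUnit (Nsig σ i β) := by
  induction i with
  | zero => simp [Nsig]
  | succ i ih => exact Nsig_succ σ i β ▸ hβ.mul (ih.map σ)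

variable {σ τ : S ≃+* S} {m : ℕ} {a b : S} {G : (Fin m → S) → (Fin m → S)}

lemma map_smul_of_isPetitIso (hm : 0 < m)
    (hG : IsPetitIso σ (stdVec m 0 a) (stdVec m 0 b) G)
    (hGS : ∀ c : S, G (stdVec m 0 c) = stdVec m 0 (τ c)) (c : S) (x : Fin m → S) :
    G (c • x) = τ c • G x := by
  simpa [petitMul_stdVec_left σ hm, hGS] using hG.2.2.2 (stdVec m 0 c) x

lemma map_tmul_iterate_of_isPetitIso (hm : 1 < m) {k : ℕ} (hk : k < m) {α : S}
    (hG : IsPetitIso σ (stdVec m 0 a) (stdVec m 0 b) G)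
    (hGt : G (stdVec m 1 1) = stdVec m k α) (i : ℕ) (x : Fin m → S) :
    G ((tmul σ (stdVec m 0 a))^[i] x) =
      Nsig (σ ^ k) i α • (tmul σ (stdVec m 0 b))^[k * i] (G x) := by
  induction i with
  | zero => simp [Nsig]
  | succ i ih =>
    have h := hG.2.2.2 (stdVec m 1 1) ((tmul σ (stdVec m 0 a))^[i] x)
    rw [petitMul_stdVec_left σ hm, hGt, petitMul_stdVec_left σ hk, ih, tmul_iterate_smul,
      one_smul, Function.iterate_one, ← Function.iterate_add_apply, smul_smul, ← Nsig_succ] at h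
    rw [Function.iterate_succ_apply', h, mul_add_one, add_comm k]

lemma pow_eq_pow_of_map_stdVec (hστ : σ * τ = τ * σ) {i r : ℕ} (hi : i < m) (hr : r < m)
    {u : S} (hu : IsUnit u)
    (hG : IsPetitIso σ (stdVec m 0 a) (stdVec m 0 b) G)
    (hGS : ∀ c : S, G (stdVec m 0 c) = stdVec m 0 (τ c))
    (hGi : G (stdVec m i 1) = stdVec m r u) : σ ^ i = σ ^ r := by
  ext d
  have h := hG.2.2.2 (stdVec m i 1) (stdVec m 0 d)
  rw [petitMul_stdVec_left σ hi, hGi, petitMul_stdVec_left σ hr, hGS,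
    tmul_iterate_stdVec_zero σ hi, tmul_iterate_stdVec_zero σ hr, one_smul,
    ← mul_one ((σ ^ i) d), ← smul_stdVec, map_smul_of_isPetitIso (by omega) hG hGS, hGi,
    smul_stdVec, smul_stdVec, mul_comm] at h
  have h' := hu.mul_left_cancel (stdVec_right_injective hr h)
  have hc : (σ ^ r) (τ d) = τ ((σ ^ r) d) :=
    RingEquiv.congr_fun (Commute.pow_left (show Commute σ τ from hστ) r).eq d
  exact τ.injective (h'.trans hc)

lemma pow_degree_eq_one_of_isPetitIso (hστ : σ * τ = τ * σ) {k : ℕ} (hk : 1 < k)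
    (hkm : k < m) {α : S} (hb : IsUnit b) (hα : IsUnit α)
    (hG : IsPetitIso σ (stdVec m 0 a) (stdVec m 0 b) G)
    (hGS : ∀ c : S, G (stdVec m 0 c) = stdVec m 0 (τ c))
    (hGt : G (stdVec m 1 1) = stdVec m k α) : σ ^ m = 1 := by
  have hm : 1 < m := hk.trans hkm
  have hσk : σ ^ k = σ := by
    simpa using (pow_eq_pow_of_map_stdVec hστ hm hkm hα hG hGS hGt).symm
  -- `i` is the least exponent for which `k * i` reaches `m`.
  obtain ⟨i, r, hir, hrk⟩ : ∃ i r, k * i = r + m ∧ r < k := by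
    refine ⟨(m + k - 1) / k, k * ((m + k - 1) / k) - m, ?_, ?_⟩ <;>
    · have h1 := Nat.div_add_mod (m + k - 1) k
      have h2 := Nat.mod_lt (m + k - 1) (show 0 < k by omega)
      omega
  have him : i < m := by nlinarith
  have hGi : G (stdVec m i 1) = stdVec m r (Nsig (σ ^ k) i α * (σ ^ r) b) := by
    have h := map_tmul_iterate_of_isPetitIso hm hkm hG hGt i (stdVec m 0 1)
    rwa [tmul_iterate_stdVec_zero σ him, hGS, map_one, map_one, hir,
      Function.iterate_add_apply, tmul_iterate_degree σ hm, map_one, one_mul,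
      tmul_iterate_stdVec_zero σ (by omega), smul_stdVec] at h
  have hσi := pow_eq_pow_of_map_stdVec hστ him (by omega)
    ((isUnit_Nsig _ i hα).mul (hb.map (σ ^ r))) hG hGS hGi
  have h : σ ^ r * σ ^ m = σ ^ r * 1 := by
    rw [← pow_add, ← hir, pow_mul, hσk, hσi, mul_one]
  exact mul_left_cancel h

end PetitAlgebra

/-- **Corollary.**  Let `a, b, α ∈ S^×`, let `τ ∈ Aut(S)` commute with `σ` and let
`G : S[t;σ]/S[t;σ](t^m−a) → S[t;σ]/S[t;σ](t^m−b)` be an isomorphism such that `G|_S = τ`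
and `G(t) = α t^k` for some `k > 1`.  Then `N_m^{σ^k}(α)·b^k = τ(a)`. -/
theorem stmt7 {S : Type*} [CommRing S] (σ τ : S ≃+* S) (hστ : σ * τ = τ * σ)
    (m k : ℕ) (hm : 1 < m) (hk : 1 < k)
    (a b α : S) (ha : IsUnit a) (hb : IsUnit b) (hα : IsUnit α)
    (G : (Fin m → S) → (Fin m → S))
    (hG : IsPetitIso σ (stdVec m 0 a) (stdVec m 0 b) G)
    (hGS : ∀ c : S, G (stdVec m 0 c) = stdVec m 0 (τ c))
    (hGt : G (stdVec m 1 1) = fun j : Fin m => if (j : ℕ) = k then α else 0) :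
    Nsig (σ ^ k) m α * b ^ k = τ a := by
  have hGt' : G (stdVec m 1 1) = stdVec m k α := hGt
  rcases lt_or_ge k m with hkm | hkm
  · have hσ := pow_degree_eq_one_of_isPetitIso hστ hk hkm hb hα hG hGS hGt'
    have h := map_tmul_iterate_of_isPetitIso hm hkm hG hGt' m (stdVec m 0 1)
    rw [tmul_iterate_degree σ hm, map_one, one_mul, hGS, hGS, map_one, mul_comm k,
      tmul_iterate_degree_mul σ hm hσ, one_mul, smul_stdVec] at h
    exact (stdVec_right_injective (by omega) h).symm
  · have h0 : G 0 = 0 := by simpa using hG.2.1 0 0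
    have ht : G (stdVec m 1 1) = 0 := by
      ext j
      simp [hGt, (j.isLt.trans_le hkm).ne]
    have h := congrFun (hG.1.injective (ht.trans h0.symm)) ⟨1, hm⟩
    have : Subsingleton S := subsingleton_of_zero_eq_one (by simpa [stdVec] using h.symm)
    exact Subsingleton.elim _ _
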